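/- arXiv:2505.19382 — 11 statements merged into one kernel-verified Lean document; each statement's English description precedes it below -/
import Mathlib

section
/- Let E be a real inner product space, let ι be a nonempty finite index set, let v : ι → E be a family of vectors, and let B ≥ 0 satisfy ‖v_i‖² ≤ B for all i ∈ ι. Then for every nonempty subset S ⊆ ι, ‖(1/|ι|) Σ_{i∈ι} v_i − (1/|S|) Σ_{i∈S} v_i‖² ≤ 4 (1 − |S|/|ι|)² B. -/
/-- The norm of a finite sum of vectors of norm at most `C` is at most the number of
summands times `C`. -/
theorem Finset.norm_sum_le_card_mul {ι E : Type*} [SeminormedAddCommGroup E]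
    {v : ι → E} {C : ℝ} (hv : ∀ i, ‖v i‖ ≤ C) (S : Finset ι) :
    ‖∑ i ∈ S, v i‖ ≤ S.card * C := by
  simpa using norm_sum_le_of_le S fun i _ => hv i

/-- Subsampled averaging error bound: if `‖v i‖² ≤ B` for all `i`, then the difference
between the full average and the average over a nonempty subset `S` satisfies
`‖avg_ι v − avg_S v‖² ≤ 4 (1 − |S|/|ι|)² B`. -/
theorem subsample_average_error_bound
    {E : Type*} [NormedAddCommGroup E] [InnerProductSpace ℝ E]
    {ι : Type*} [Fintype ι] [Nonempty ι]
    (v : ι → E) (B : ℝ) (hB : 0 ≤ B) (hv : ∀ i, ‖v i‖ ^ 2 ≤ B)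
    (S : Finset ι) (hS : S.Nonempty) :
    ‖(1 / (Fintype.card ι : ℝ)) • ∑ i, v i - (1 / (S.card : ℝ)) • ∑ i ∈ S, v i‖ ^ 2
      ≤ 4 * (1 - (S.card : ℝ) / (Fintype.card ι : ℝ)) ^ 2 * B := by
  classical
  have hv' (i : ι) : ‖v i‖ ≤ √B := Real.le_sqrt_of_sq_le (hv i)
  have hs : (0 : ℝ) < S.card := by exact_mod_cast hS.card_pos
  have hn : (0 : ℝ) < Fintype.card ι := by exact_mod_cast Fintype.card_pos
  have hsn : (S.card : ℝ) ≤ Fintype.card ι := by exact_mod_cast S.card_le_univ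
  have hcompl : (Sᶜ.card : ℝ) = Fintype.card ι - S.card := by
    rw [Finset.card_compl, Nat.cast_sub S.card_le_univ]
  have hsum := Finset.norm_sum_le_card_mul hv' S
  have hsum_compl := Finset.norm_sum_le_card_mul hv' Sᶜ
  rw [hcompl] at hsum_compl
  rw [← Finset.sum_add_sum_compl S v]
  set s := (S.card : ℝ)
  set n := (Fintype.card ι : ℝ)
  have hcoef : 0 ≤ 1 / s - 1 / n := sub_nonneg.2 (one_div_le_one_div_of_le hs hsn)
  have hnorm : ‖(1 / n) • (∑ i ∈ S, v i + ∑ i ∈ Sᶜ, v i) - (1 / s) • ∑ i ∈ S, v i‖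
      ≤ 2 * (1 - s / n) * √B :=
    calc
      _ = ‖(1 / n) • ∑ i ∈ Sᶜ, v i - (1 / s - 1 / n) • ∑ i ∈ S, v i‖ := by
        congr 1
        module
      _ ≤ (1 / n) * ‖∑ i ∈ Sᶜ, v i‖ + (1 / s - 1 / n) * ‖∑ i ∈ S, v i‖ := by
        refine (norm_sub_le _ _).trans_eq ?_
        rw [norm_smul_of_nonneg (by positivity), norm_smul_of_nonneg hcoef]
      _ ≤ (1 / n) * ((n - s) * √B) + (1 / s - 1 / n) * (s * √B) := by gcongr
      _ = 2 * (1 - s / n) * √B := by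
        field_simp
        ring
  calc
    _ ≤ (2 * (1 - s / n) * √B) ^ 2 := by gcongr
    _ = 4 * (1 - s / n) ^ 2 * B := by
      rw [mul_pow, Real.sq_sqrt hB]
      ring
end

section
/- Let f, F : ℝⁿ → ℝ be differentiable, let c : ℝⁿ → ℝᵐ be differentiable, and write g = ∇F. For x ∈ ℝⁿ and λ ∈ ℝᵐ define T(x, λ) = (∇f(x) + Σ_{i=1}^m λ_i ∇c_i(x), c(x)) ∈ ℝⁿ × ℝᵐ and T_S(x, λ) = (g(x) + Σ_{i=1}^m λ_i ∇c_i(x), c(x)), with the Euclidean norm on ℝⁿ × ℝᵐ. Let γ ≥ 0, ε ≥ 0, let x₀, x_N ∈ ℝⁿ and λ₋, λ₀, λ_N ∈ ℝᵐ, and assume: (i) ‖T_S(x₀, λ₀)‖ ≤ ‖T_S(x₀, λ₋)‖; (ii) ‖T_S(x_N, λ_N)‖ ≤ γ ‖T_S(x₀, λ₀)‖ + ε. Then ‖T(x_N, λ_N)‖ ≤ γ ‖T(x₀, λ₋)‖ + ε + ‖∇f(x_N) − g(x_N)‖ + γ ‖∇f(x₀) − g(x₀)‖. -/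
/-- The Euclidean norm on a product: `‖(a, b)‖ = √(‖a‖² + ‖b‖²)`. -/
noncomputable def prodNorm {E F : Type*} [NormedAddCommGroup E] [NormedAddCommGroup F]
    (a : E) (b : F) : ℝ :=
  Real.sqrt (‖a‖ ^ 2 + ‖b‖ ^ 2)

theorem prodNorm_le_prodNorm_add_norm_sub {E F : Type*} [NormedAddCommGroup E]
    [NormedAddCommGroup F] (a a' : E) (b : F) :
    prodNorm a b ≤ prodNorm a' b + ‖a - a'‖ := by
  have hs : ‖a'‖ ≤ prodNorm a' b := Real.le_sqrt_of_sq_le (by linarith [sq_nonneg ‖b‖])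
  have hsq : prodNorm a' b ^ 2 = ‖a'‖ ^ 2 + ‖b‖ ^ 2 := Real.sq_sqrt (by positivity)
  have htri : ‖a‖ ≤ ‖a'‖ + ‖a - a'‖ := norm_le_norm_add_norm_sub' a a'
  have ha : ‖a‖ ^ 2 ≤ (‖a'‖ + ‖a - a'‖) ^ 2 := by gcongr
  have hmul := mul_le_mul_of_nonneg_right hs (norm_nonneg (a - a'))
  refine Real.sqrt_le_iff.mpr ⟨add_nonneg (Real.sqrt_nonneg _) (norm_nonneg _), ?_⟩
  linarith [add_sq ‖a'‖ ‖a - a'‖, add_sq (prodNorm a' b) ‖a - a'‖]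

/-- Lemma 2.1 (single outer iteration): bound on the true KKT residual
`T(x_N, λ_N)` in terms of the subsampled termination criterion and gradient errors.
Here `T(x, λ)` is the Euclidean norm of `(∇f(x) + Σ λᵢ ∇cᵢ(x), c(x))` and `T_S` uses
`g = ∇F` in place of `∇f`. -/
theorem kkt_error_single_outer_iteration
    {n m : ℕ}
    (f F : EuclideanSpace ℝ (Fin n) → ℝ)
    (c : EuclideanSpace ℝ (Fin n) → EuclideanSpace ℝ (Fin m))
    (hf : Differentiable ℝ f) (hF : Differentiable ℝ F) (hc : Differentiable ℝ c)
    (γ ε : ℝ) (hγ : 0 ≤ γ) (hε : 0 ≤ ε)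
    (x₀ xN : EuclideanSpace ℝ (Fin n))
    (lamPrev lam₀ lamN : EuclideanSpace ℝ (Fin m))
    -- (i) the initialized dual does at least as well as the carried-over dual:
    (h1 : prodNorm (gradient F x₀ + ∑ i, lam₀ i • gradient (fun y => c y i) x₀) (c x₀)
        ≤ prodNorm (gradient F x₀ + ∑ i, lamPrev i • gradient (fun y => c y i) x₀) (c x₀))
    -- (ii) the inner-loop termination criterion:
    (h2 : prodNorm (gradient F xN + ∑ i, lamN i • gradient (fun y => c y i) xN) (c xN)
        ≤ γ * prodNorm (gradient F x₀ + ∑ i, lam₀ i • gradient (fun y => c y i) x₀) (c x₀)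
          + ε) :
    prodNorm (gradient f xN + ∑ i, lamN i • gradient (fun y => c y i) xN) (c xN)
      ≤ γ * prodNorm (gradient f x₀ + ∑ i, lamPrev i • gradient (fun y => c y i) x₀) (c x₀)
        + ε + ‖gradient f xN - gradient F xN‖ + γ * ‖gradient f x₀ - gradient F x₀‖ := by
  have hN := prodNorm_le_prodNorm_add_norm_sub
    (gradient f xN + ∑ i, lamN i • gradient (fun y => c y i) xN)
    (gradient F xN + ∑ i, lamN i • gradient (fun y => c y i) xN) (c xN)
  have h₀ := prodNorm_le_prodNorm_add_norm_sub
    (gradient F x₀ + ∑ i, lamPrev i • gradient (fun y => c y i) x₀)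
    (gradient f x₀ + ∑ i, lamPrev i • gradient (fun y => c y i) x₀) (c x₀)
  rw [add_sub_add_right_eq_sub] at hN h₀
  rw [norm_sub_rev] at h₀
  have hγ₀ := mul_le_mul_of_nonneg_left (h1.trans h₀) hγ
  rw [mul_add] at hγ₀
  linarith
end

section
/- Let 𝒮 be a nonempty finite set, let F(·, ξ) : ℝⁿ → ℝ be continuously differentiable for each ξ ∈ 𝒮, let f(x) = (1/|𝒮|) Σ_{ξ∈𝒮} F(x, ξ), and for nonempty S ⊆ 𝒮 let g_S(x) = (1/|S|) Σ_{ξ∈S} ∇F(x, ξ). Let c : ℝⁿ → ℝᵐ be continuously differentiable and define the KKT residuals T(x,λ) = (∇f(x) + Σ_i λ_i ∇c_i(x), c(x)) and T_S(x,λ) = (g_S(x) + Σ_i λ_i ∇c_i(x), c(x)). Let (x_k)_{k≥0} ⊆ ℝⁿ, (λ_k)_{k≥0} ⊆ ℝᵐ, nonempty subsets S_k ⊆ 𝒮 (k ≥ 1), reals γ_k ∈ [0, γ] with γ < 1, and ε_k ≥ 0. Assume: (i) ‖T_{S_k}(x_k, λ_k)‖ ≤ γ_k ‖T_{S_k}(x_{k−1},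 λ_{k−1})‖ + ε_k for all k ≥ 1; (ii) there are ω₁, ω₂ ≥ 0 with ‖∇F(x, ξ)‖² ≤ ω₁² ‖∇f(x)‖² + ω₂² for all x ∈ ℝⁿ and ξ ∈ 𝒮; (iii) there is κ_g ≥ 0 with ‖∇f(x_k)‖ ≤ κ_g for all k ≥ 0; (iv) ε_k → 0 and |S_k| → |𝒮| as k → ∞. Then ‖T(x_k, λ_k)‖ → 0 as k → ∞. -/
/-- Finite-sum objective: `f(x) = (1/|𝒮|) Σ_{ξ∈𝒮} F(x, ξ)`. -/
noncomputable def favg {n : ℕ} {ι : Type*} [Fintype ι]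
    (F : ι → EuclideanSpace ℝ (Fin n) → ℝ) (x : EuclideanSpace ℝ (Fin n)) : ℝ :=
  (1 / (Fintype.card ι : ℝ)) * ∑ ξ, F ξ x

/-- Subsampled gradient: `g_S(x) = (1/|S|) Σ_{ξ∈S} ∇F(x, ξ)`. -/
noncomputable def gsub {n : ℕ} {ι : Type*}
    (F : ι → EuclideanSpace ℝ (Fin n) → ℝ) (S : Finset ι)
    (x : EuclideanSpace ℝ (Fin n)) : EuclideanSpace ℝ (Fin n) :=
  (1 / (S.card : ℝ)) • ∑ ξ ∈ S, gradient (F ξ) x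

/-- Euclidean norm of the KKT residual `(g + Σ λᵢ ∇cᵢ(x), c(x))`. -/
noncomputable def kktNorm {n m : ℕ} (g : EuclideanSpace ℝ (Fin n))
    (c : EuclideanSpace ℝ (Fin n) → EuclideanSpace ℝ (Fin m))
    (x : EuclideanSpace ℝ (Fin n)) (lam : EuclideanSpace ℝ (Fin m)) : ℝ :=
  Real.sqrt (‖g + ∑ i, lam i • gradient (fun y => c y i) x‖ ^ 2 + ‖c x‖ ^ 2)

open Filter Topology in
/-- A nonnegative sequence which eventually contracts up to a vanishing perturbation tends to zero. -/
theorem tendsto_zero_of_eventually_le_mul_add {a ε : ℕ → ℝ} {γ : ℝ} (ha : ∀ k, 0 ≤ a k)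
    (hγ₀ : 0 ≤ γ) (hγ : γ < 1) (hε : Tendsto ε atTop (𝓝 0))
    (h : ∀ᶠ k in atTop, a (k + 1) ≤ γ * a k + ε k) : Tendsto a atTop (𝓝 0) := by
  refine tendsto_order.2 ⟨fun b hb => .of_forall fun k => hb.trans_le (ha k), fun b hb => ?_⟩
  have hpos : 0 < (1 - γ) * (b / 2) := mul_pos (by linarith) (by linarith)
  obtain ⟨N, hN⟩ := eventually_atTop.1 (h.and (hε.eventually_lt_const hpos))
  have key : ∀ j, a (j + N) ≤ b / 2 + γ ^ j * a N := by
    intro j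
    induction j with
    | zero => simp only [Nat.zero_add, pow_zero, one_mul]; linarith
    | succ j ih =>
      obtain ⟨h₁, h₂⟩ := hN (j + N) (Nat.le_add_left N j)
      have h₃ := mul_le_mul_of_nonneg_left ih hγ₀
      rw [Nat.add_right_comm, pow_succ]
      linarith
  have hlim : Tendsto (fun j => b / 2 + γ ^ j * a N) atTop (𝓝 (b / 2 + 0 * a N)) :=
    ((tendsto_pow_atTop_nhds_zero_of_lt_one hγ₀ hγ).mul_const _).const_add _
  have hev := hlim.eventually_lt_const (show b / 2 + 0 * a N < b by linarith)
  rw [← map_add_atTop_eq_nat N, eventually_map]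
  exact hev.mono fun j hj => (key j).trans_lt hj

/-- The gradient subsampled on the full batch is the gradient of the finite-sum objective. -/
theorem gsub_univ_eq_gradient_favg {n : ℕ} {ι : Type*} [Fintype ι]
    {F : ι → EuclideanSpace ℝ (Fin n) → ℝ} {x : EuclideanSpace ℝ (Fin n)}
    (hF : ∀ ξ, DifferentiableAt ℝ (F ξ) x) :
    gsub F Finset.univ x = gradient (favg F) x := by
  have h : HasFDerivAt (favg F)
      ((1 / (Fintype.card ι : ℝ)) • ∑ ξ, fderiv ℝ (F ξ) x) x :=
    (HasFDerivAt.fun_sum fun ξ _ => (hF ξ).hasFDerivAt).const_mul _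
  simp only [gsub, gradient, h.fderiv, Finset.card_univ, map_smulₛₗ, map_sum, conj_trivial]

open Filter Topology in
/-- Finite sets whose cardinality tends to that of the whole type are eventually everything. -/
theorem eventually_eq_univ_of_tendsto_card {α ι : Type*} [Fintype ι] {l : Filter α}
    {S : α → Finset ι} (h : Tendsto (fun k => ((S k).card : ℝ)) l (𝓝 (Fintype.card ι))) :
    ∀ᶠ k in l, S k = Finset.univ := by
  filter_upwards [h.eventually_const_lt (sub_one_lt (Fintype.card ι : ℝ))] with k hk
  refine Finset.eq_univ_of_card _ ((Finset.card_le_univ _).antisymm ?_)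
  have : (Fintype.card ι : ℝ) < ((S k).card + 1 : ℕ) := by push_cast; linarith
  exact Nat.lt_succ_iff.1 (Nat.cast_lt.1 this)

/-- Theorem 2.1(1): convergence of the equality-constrained RA framework
for the finite-sum problem. -/
theorem ra_equality_finite_sum_convergence
    {n m : ℕ} {ι : Type*} [Fintype ι] [Nonempty ι]
    (F : ι → EuclideanSpace ℝ (Fin n) → ℝ) (hF : ∀ ξ, ContDiff ℝ 1 (F ξ))
    (c : EuclideanSpace ℝ (Fin n) → EuclideanSpace ℝ (Fin m)) (hc : ContDiff ℝ 1 c)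
    (x : ℕ → EuclideanSpace ℝ (Fin n)) (lam : ℕ → EuclideanSpace ℝ (Fin m))
    (S : ℕ → Finset ι) (hS : ∀ k, (S (k + 1)).Nonempty)
    (γk : ℕ → ℝ) (γ : ℝ) (hγk : ∀ k, 0 ≤ γk k ∧ γk k ≤ γ) (hγ : γ < 1)
    (εk : ℕ → ℝ) (hεk : ∀ k, 0 ≤ εk k)
    -- (i) termination criterion combined with the dual initialization rule:
    (hterm : ∀ k,
      kktNorm (gsub F (S (k + 1)) (x (k + 1))) c (x (k + 1)) (lam (k + 1))
        ≤ γk (k + 1) * kktNorm (gsub F (S (k + 1)) (x k)) c (x k) (lam k) + εk (k + 1))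
    -- (ii) bounded individual component gradients:
    (ω₁ ω₂ : ℝ) (hω₁ : 0 ≤ ω₁) (hω₂ : 0 ≤ ω₂)
    (hgradbound : ∀ (y : EuclideanSpace ℝ (Fin n)) (ξ : ι),
      ‖gradient (F ξ) y‖ ^ 2 ≤ ω₁ ^ 2 * ‖gradient (favg F) y‖ ^ 2 + ω₂ ^ 2)
    -- (iii) bounded true gradients along the iterates:
    (κg : ℝ) (hκg : 0 ≤ κg)
    (hbound : ∀ k, ‖gradient (favg F) (x k)‖ ≤ κg)
    -- (iv) vanishing tolerances and full batches in the limit: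
    (hε0 : Filter.Tendsto εk Filter.atTop (nhds 0))
    (hScard : Filter.Tendsto (fun k => ((S k).card : ℝ)) Filter.atTop
      (nhds (Fintype.card ι))) :
    Filter.Tendsto (fun k => kktNorm (gradient (favg F) (x k)) c (x k) (lam k))
      Filter.atTop (nhds 0) := by
  refine tendsto_zero_of_eventually_le_mul_add (fun _ => Real.sqrt_nonneg _)
    ((hγk 0).1.trans (hγk 0).2) hγ (hε0.comp (Filter.tendsto_add_atTop_nat 1)) ?_
  filter_upwards [(Filter.tendsto_add_atTop_nat 1).eventually
    (eventually_eq_univ_of_tendsto_card hScard)] with k hk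
  have hfull : ∀ y, gsub F (S (k + 1)) y = gradient (favg F) y := fun y => by
    rw [hk, gsub_univ_eq_gradient_favg fun ξ => (hF ξ).differentiable one_ne_zero y]
  have hstep := hterm k
  simp only [hfull] at hstep
  exact hstep.trans (add_le_add_left
    (mul_le_mul_of_nonneg_right (hγk (k + 1)).2 (Real.sqrt_nonneg _)) _)
end

section
/- With the finite-sum setup (𝒮 finite nonempty, F(·,ξ) continuously differentiable, f the average, g_S the subsample-average gradient, c continuously differentiable, and KKT residuals T and T_S as defined), let (x_k)_{k≥0}, (λ_k)_{k≥0}, S_k ⊆ 𝒮 nonempty (k ≥ 1), γ_k ∈ [0, γ] with γ < 1, ω, ω̂, θ, θ̂, a ≥ 0, β ∈ (0,1). Assume for all k ≥ 1: (i) ‖T_{S_k}(x_k, λ_k)‖ ≤ γ_k ‖T_{S_k}(x_{k−1}, λ_{k−1})‖ + ε_k with ε_k = ω ‖∇f(x_{k−1}) − g_{S_k}(x_{k−1})‖ + ω̂ β^k; (ii) ‖∇f(x_{k−1}) − g_{S_k}(x_{k−1})‖² ≤ θ² ‖T(x_{k−1}, λ_{k−1})‖² + a² β^{2k} and ‖∇f(x_k)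 − g_{S_k}(x_k)‖² ≤ θ̂² (θ² ‖T(x_{k−1}, λ_{k−1})‖² + a² β^{2k}); (iii) a₁ := γ + θ(ω + θ̂ + γ) < 1, and ν > 0 satisfies a₁ + ν < 1. Then for all k ≥ 0, ‖T(x_k, λ_k)‖ ≤ (max{a₁ + ν, β})^k · max{‖T(x₀, λ₀)‖, a₂/ν}, where a₂ = a(ω + θ̂ + γ) + ω̂. -/
theorem kktNorm_nonneg {n m : ℕ} (g : EuclideanSpace ℝ (Fin n))
    (c : EuclideanSpace ℝ (Fin n) → EuclideanSpace ℝ (Fin m))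
    (x : EuclideanSpace ℝ (Fin n)) (lam : EuclideanSpace ℝ (Fin m)) :
    0 ≤ kktNorm g c x lam :=
  Real.sqrt_nonneg _

/-- The KKT residual norm is 1-Lipschitz in the gradient argument. -/
theorem kktNorm_le_add_norm_sub {n m : ℕ} (g h : EuclideanSpace ℝ (Fin n))
    (c : EuclideanSpace ℝ (Fin n) → EuclideanSpace ℝ (Fin m))
    (x : EuclideanSpace ℝ (Fin n)) (lam : EuclideanSpace ℝ (Fin m)) :
    kktNorm g c x lam ≤ kktNorm h c x lam + ‖g - h‖ := by
  unfold kktNorm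
  set v := ∑ i, lam i • gradient (fun y => c y i) x
  have tri : ‖g + v‖ ≤ ‖h + v‖ + ‖g - h‖ := by
    calc ‖g + v‖ = ‖(h + v) + (g - h)‖ := by congr 1; abel
      _ ≤ _ := norm_add_le _ _
  have hle : ‖h + v‖ ≤ √(‖h + v‖ ^ 2 + ‖c x‖ ^ 2) :=
    Real.le_sqrt_of_sq_le (le_add_of_nonneg_right (sq_nonneg _))
  have hsq : √(‖h + v‖ ^ 2 + ‖c x‖ ^ 2) ^ 2 = ‖h + v‖ ^ 2 + ‖c x‖ ^ 2 :=
    Real.sq_sqrt (by positivity)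
  refine Real.sqrt_le_iff.mpr ⟨by positivity, ?_⟩
  have h1 := pow_le_pow_left₀ (norm_nonneg _) tri 2
  have h2 := mul_le_mul_of_nonneg_right hle (norm_nonneg (g - h))
  linear_combination h1 + 2 * h2 - hsq

theorem le_add_of_sq_le_sq_add_sq {d p q : ℝ} (hp : 0 ≤ p) (hq : 0 ≤ q)
    (h : d ^ 2 ≤ p ^ 2 + q ^ 2) : d ≤ p + q :=
  le_of_sq_le_sq (by linear_combination h + 2 * mul_nonneg hp hq) (add_nonneg hp hq)

/-- A linear recursion with a geometrically vanishing perturbation converges linearly. -/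
theorem le_max_pow_mul_max_of_le_mul_add {T : ℕ → ℝ} {r b β ν : ℝ} (hr : 0 ≤ r) (hb : 0 ≤ b)
    (hβ0 : 0 ≤ β) (hβ1 : β ≤ 1) (hν : 0 < ν)
    (hT : ∀ k, T (k + 1) ≤ r * T k + b * β ^ (k + 1)) (k : ℕ) :
    T k ≤ max (r + ν) β ^ k * max (T 0) (b / ν) := by
  induction k with
  | zero => simp
  | succ k ih =>
    set ρ := max (r + ν) β
    set M := max (T 0) (b / ν)
    have hM : 0 ≤ M := (div_nonneg hb hν.le).trans (le_max_right _ _)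
    have hbM : b ≤ M * ν := (div_le_iff₀ hν).mp (le_max_right _ _)
    have hρ : 0 ≤ ρ := hβ0.trans (le_max_right _ _)
    have hβρ : β ^ (k + 1) ≤ ρ ^ k :=
      (pow_le_pow_of_le_one hβ0 hβ1 k.le_succ).trans
        (pow_le_pow_left₀ hβ0 (le_max_right _ _) k)
    calc T (k + 1) ≤ r * T k + b * β ^ (k + 1) := hT k
      _ ≤ r * (ρ ^ k * M) + M * ν * ρ ^ k := by gcongr
      _ = (r + ν) * (ρ ^ k * M) := by ring
      _ ≤ ρ * (ρ ^ k * M) := by gcongr; exact le_max_left _ _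
      _ = ρ ^ (k + 1) * M := by ring

/-- Theorem 2.2(1): linear convergence of the true KKT error across outer iterations
of the equality-constrained RA framework for the finite-sum problem, under the
adaptive sampling condition. -/
theorem ra_equality_finite_sum_linear_rate
    {n m : ℕ} {ι : Type*} [Fintype ι] [Nonempty ι]
    (F : ι → EuclideanSpace ℝ (Fin n) → ℝ) (hF : ∀ ξ, ContDiff ℝ 1 (F ξ))
    (c : EuclideanSpace ℝ (Fin n) → EuclideanSpace ℝ (Fin m)) (hc : ContDiff ℝ 1 c)
    (x : ℕ → EuclideanSpace ℝ (Fin n)) (lam : ℕ → EuclideanSpace ℝ (Fin m))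
    (S : ℕ → Finset ι) (hS : ∀ k, (S (k + 1)).Nonempty)
    (γk : ℕ → ℝ) (γ : ℝ) (hγk : ∀ k, 0 ≤ γk k ∧ γk k ≤ γ) (hγ : γ < 1)
    (ω ωh θ θh a : ℝ)
    (hω : 0 ≤ ω) (hωh : 0 ≤ ωh) (hθ : 0 ≤ θ) (hθh : 0 ≤ θh) (ha : 0 ≤ a)
    (β : ℝ) (hβ0 : 0 < β) (hβ1 : β < 1)
    -- (i) termination criterion with tolerance ε_k = ω‖∇f(x_{k-1}) − g_{S_k}(x_{k-1})‖ + ω̂βᵏ: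
    (hterm : ∀ k,
      kktNorm (gsub F (S (k + 1)) (x (k + 1))) c (x (k + 1)) (lam (k + 1))
        ≤ γk (k + 1) * kktNorm (gsub F (S (k + 1)) (x k)) c (x k) (lam k)
          + (ω * ‖gradient (favg F) (x k) - gsub F (S (k + 1)) (x k)‖ + ωh * β ^ (k + 1)))
    -- (ii) adaptive sampling (norm test) condition:
    (hsamp₁ : ∀ k,
      ‖gradient (favg F) (x k) - gsub F (S (k + 1)) (x k)‖ ^ 2
        ≤ θ ^ 2 * (kktNorm (gradient (favg F) (x k)) c (x k) (lam k)) ^ 2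
          + a ^ 2 * β ^ (2 * (k + 1)))
    (hsamp₂ : ∀ k,
      ‖gradient (favg F) (x (k + 1)) - gsub F (S (k + 1)) (x (k + 1))‖ ^ 2
        ≤ θh ^ 2 * (θ ^ 2 * (kktNorm (gradient (favg F) (x k)) c (x k) (lam k)) ^ 2
          + a ^ 2 * β ^ (2 * (k + 1))))
    -- (iii) contraction-factor condition:
    (ha₁ : γ + θ * (ω + θh + γ) < 1)
    (ν : ℝ) (hν : 0 < ν) (hν₁ : γ + θ * (ω + θh + γ) + ν < 1) :
    ∀ k, kktNorm (gradient (favg F) (x k)) c (x k) (lam k)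
      ≤ (max (γ + θ * (ω + θh + γ) + ν) β) ^ k
        * max (kktNorm (gradient (favg F) (x 0)) c (x 0) (lam 0))
            ((a * (ω + θh + γ) + ωh) / ν) := by
  have hγ0 : 0 ≤ γ := (hγk 0).1.trans (hγk 0).2
  refine le_max_pow_mul_max_of_le_mul_add
    (T := fun k => kktNorm (gradient (favg F) (x k)) c (x k) (lam k))
    (by positivity) (by positivity) hβ0.le hβ1.le hν fun k => ?_
  have hT0 := kktNorm_nonneg (gradient (favg F) (x k)) c (x k) (lam k)
  have hTnext := kktNorm_le_add_norm_sub (gradient (favg F) (x (k + 1)))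
    (gsub F (S (k + 1)) (x (k + 1))) c (x (k + 1)) (lam (k + 1))
  have hTS := kktNorm_le_add_norm_sub (gsub F (S (k + 1)) (x k))
    (gradient (favg F) (x k)) c (x k) (lam k)
  rw [norm_sub_rev] at hTS
  have hTS0 := kktNorm_nonneg (gsub F (S (k + 1)) (x k)) c (x k) (lam k)
  have hterm := hterm k
  have hs₁ := hsamp₁ k
  have hs₂ := hsamp₂ k
  set T := kktNorm (gradient (favg F) (x k)) c (x k) (lam k)
  set TS := kktNorm (gsub F (S (k + 1)) (x k)) c (x k) (lam k)
  set e := ‖gradient (favg F) (x k) - gsub F (S (k + 1)) (x k)‖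
  set e' := ‖gradient (favg F) (x (k + 1)) - gsub F (S (k + 1)) (x (k + 1))‖
  have he : e ≤ θ * T + a * β ^ (k + 1) :=
    le_add_of_sq_le_sq_add_sq (by positivity) (by positivity) (hs₁.trans_eq (by ring))
  have he' : e' ≤ θh * (θ * T) + θh * (a * β ^ (k + 1)) :=
    le_add_of_sq_le_sq_add_sq (by positivity) (by positivity) (hs₂.trans_eq (by ring))
  have h₁ : γk (k + 1) * TS ≤ γ * (T + e) :=
    mul_le_mul (hγk (k + 1)).2 hTS hTS0 hγ0
  have h₂ := mul_le_mul_of_nonneg_left he (add_nonneg hγ0 hω)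
  linear_combination hTnext + hterm + h₁ + h₂ + he'
end

section
/- With the finite-sum setup (𝒮 finite nonempty, F(·,ξ) continuously differentiable, f(x) = (1/|𝒮|)Σ_{ξ∈𝒮}F(x,ξ), g_S(x) = (1/|S|)Σ_{ξ∈S}∇F(x,ξ)), suppose ‖∇F(x, ξ)‖² ≤ ω₁² ‖∇f(x)‖² + ω₂² for all ξ ∈ 𝒮, where ω₁² κ_g² + ω₂² > 0. Let x ∈ ℝⁿ with ‖∇f(x)‖ ≤ κ_g, let θ, a ≥ 0, β ∈ (0,1), k ≥ 0, and Z ≥ 0. If S ⊆ 𝒮 is nonempty with |S| ≥ |𝒮| (1 − √((θ² Z² + a² β^{2k}) / (4(ω₁² κ_g² + ω₂²)))), then ‖∇f(x) − g_S(x)‖² ≤ θ² Z² + a² β^{2k}. -/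
/-- The gradient of a finite average is the average of the gradients. -/
theorem gradient_favg {n : ℕ} {ι : Type*} [Fintype ι]
    {F : ι → EuclideanSpace ℝ (Fin n) → ℝ} {x : EuclideanSpace ℝ (Fin n)}
    (hF : ∀ ξ, DifferentiableAt ℝ (F ξ) x) :
    gradient (favg F) x = (1 / (Fintype.card ι : ℝ)) • ∑ ξ, gradient (F ξ) x := by
  have h : HasFDerivAt (favg F) ((1 / (Fintype.card ι : ℝ)) • ∑ ξ, fderiv ℝ (F ξ) x) x :=
    (HasFDerivAt.fun_sum fun ξ _ => (hF ξ).hasFDerivAt).const_mul _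
  simp only [gradient, h.fderiv, map_smulₛₗ, map_sum, conj_trivial]

/-- The average of a bounded family and its average over a nonempty subset differ by at most
twice the bound times the proportion of omitted indices. -/
theorem norm_average_sub_average_le {ι E : Type*} [Fintype ι] [SeminormedAddCommGroup E]
    [NormedSpace ℝ E] {v : ι → E} {M : ℝ} (hv : ∀ i, ‖v i‖ ≤ M) {S : Finset ι}
    (hS : S.Nonempty) :
    ‖(1 / (Fintype.card ι : ℝ)) • ∑ i, v i - (1 / (S.card : ℝ)) • ∑ i ∈ S, v i‖
      ≤ 2 * (1 - (S.card : ℝ) / Fintype.card ι) * M := by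
  classical
  have hs : (0 : ℝ) < S.card := by exact_mod_cast hS.card_pos
  have hsN : (S.card : ℝ) ≤ Fintype.card ι := by exact_mod_cast S.card_le_univ
  have hN : (0 : ℝ) < Fintype.card ι := hs.trans_le hsN
  have hcompl : ((Sᶜ).card : ℝ) = Fintype.card ι - S.card := by
    rw [Finset.card_compl, Nat.cast_sub S.card_le_univ]
  have hsum (T : Finset ι) : ‖∑ i ∈ T, v i‖ ≤ T.card * M := by
    simpa using norm_sum_le_of_le T fun i _ => hv i
  have hinv : (0 : ℝ) ≤ 1 / S.card - 1 / Fintype.card ι :=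
    sub_nonneg.2 (one_div_le_one_div_of_le hs hsN)
  have hsplit : (1 / (Fintype.card ι : ℝ)) • ∑ i, v i - (1 / (S.card : ℝ)) • ∑ i ∈ S, v i
      = (1 / (Fintype.card ι : ℝ)) • ∑ i ∈ Sᶜ, v i
        - (1 / (S.card : ℝ) - 1 / Fintype.card ι) • ∑ i ∈ S, v i := by
    rw [← Finset.sum_add_sum_compl S v]
    module
  rw [hsplit]
  calc
    _ ≤ (1 / (Fintype.card ι : ℝ)) * ‖∑ i ∈ Sᶜ, v i‖
        + (1 / (S.card : ℝ) - 1 / Fintype.card ι) * ‖∑ i ∈ S, v i‖ := by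
      refine (norm_sub_le _ _).trans_eq ?_
      rw [norm_smul_of_nonneg (by positivity), norm_smul_of_nonneg hinv]
    _ ≤ (1 / (Fintype.card ι : ℝ)) * ((Sᶜ).card * M)
        + (1 / (S.card : ℝ) - 1 / Fintype.card ι) * (S.card * M) := by
      gcongr <;> exact hsum _
    _ = 2 * (1 - (S.card : ℝ) / Fintype.card ι) * M := by
      rw [hcompl]
      field_simp
      ring

/-- Lemma 2.2(1): a sufficiently large batch size satisfies the norm-test sampling
condition in the finite-sum case (with `θ̂ = 1`). -/
theorem sufficient_batch_size_norm_test_finite_sum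
    {n : ℕ} {ι : Type*} [Fintype ι] [Nonempty ι]
    (F : ι → EuclideanSpace ℝ (Fin n) → ℝ) (hF : ∀ ξ, ContDiff ℝ 1 (F ξ))
    (ω₁ ω₂ : ℝ) (hω₁ : 0 ≤ ω₁) (hω₂ : 0 ≤ ω₂) (κg : ℝ)
    (hgradbound : ∀ (y : EuclideanSpace ℝ (Fin n)) (ξ : ι),
      ‖gradient (F ξ) y‖ ^ 2 ≤ ω₁ ^ 2 * ‖gradient (favg F) y‖ ^ 2 + ω₂ ^ 2)
    (hpos : 0 < ω₁ ^ 2 * κg ^ 2 + ω₂ ^ 2)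
    (x : EuclideanSpace ℝ (Fin n)) (hx : ‖gradient (favg F) x‖ ≤ κg)
    (θ a : ℝ) (hθ : 0 ≤ θ) (ha : 0 ≤ a) (β : ℝ) (hβ0 : 0 < β) (hβ1 : β < 1)
    (k : ℕ) (Z : ℝ) (hZ : 0 ≤ Z)
    (S : Finset ι) (hSne : S.Nonempty)
    (hcard : (Fintype.card ι : ℝ)
        * (1 - Real.sqrt ((θ ^ 2 * Z ^ 2 + a ^ 2 * β ^ (2 * k))
            / (4 * (ω₁ ^ 2 * κg ^ 2 + ω₂ ^ 2))))
      ≤ (S.card : ℝ)) :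
    ‖gradient (favg F) x - gsub F S x‖ ^ 2 ≤ θ ^ 2 * Z ^ 2 + a ^ 2 * β ^ (2 * k) := by
  have hN : (0 : ℝ) < Fintype.card ι := by exact_mod_cast Fintype.card_pos
  have hsN : (S.card : ℝ) ≤ Fintype.card ι := by exact_mod_cast S.card_le_univ
  set C := ω₁ ^ 2 * κg ^ 2 + ω₂ ^ 2 with hC
  set T := θ ^ 2 * Z ^ 2 + a ^ 2 * β ^ (2 * k) with hT
  have hT0 : 0 ≤ T := by positivity
  have hbound (ξ : ι) : ‖gradient (F ξ) x‖ ≤ Real.sqrt C := by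
    refine Real.le_sqrt_of_sq_le ((hgradbound x ξ).trans ?_)
    rw [hC]
    gcongr
  have hdiff := norm_average_sub_average_le hbound hSne
  rw [← gradient_favg fun ξ => (hF ξ).differentiable one_ne_zero x] at hdiff
  change ‖gradient (favg F) x - gsub F S x‖ ≤ _ at hdiff
  have hfrac : 0 ≤ 1 - (S.card : ℝ) / Fintype.card ι := sub_nonneg.2 ((div_le_one hN).2 hsN)
  have hfrac_le : 1 - (S.card : ℝ) / Fintype.card ι ≤ Real.sqrt (T / (4 * C)) := by
    rw [sub_le_comm, le_div_iff₀ hN, mul_comm]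
    exact hcard
  calc
    _ ≤ (2 * Real.sqrt (T / (4 * C)) * Real.sqrt C) ^ 2 := by
      refine pow_le_pow_left₀ (norm_nonneg _) (hdiff.trans ?_) 2
      gcongr
    _ = T := by
      rw [mul_pow, mul_pow, Real.sq_sqrt (by positivity), Real.sq_sqrt hpos.le]
      field_simp
      ring
end

section
/- Let H be a symmetric real n×n matrix, J a real m×n matrix, and M the (n+m)×(n+m) block matrix M = [[H, Jᵀ], [J, 0]]. Suppose M is invertible and ‖M⁻¹‖ ≤ 1/κ for some κ > 0 (operator norm induced by the Euclidean norm). Let d, d̂ ∈ ℝⁿ and δ, δ̂ ∈ ℝᵐ satisfy M (d − d̂, δ − δ̂) = (ρ, r) for some ρ ∈ ℝⁿ, r ∈ ℝᵐ with ‖(ρ, r)‖ ≤ κ_T ‖d‖, where 0 ≤ κ_T and κ_T/κ < 1/2. Then ‖d − d̂‖ ≤ η_d ‖d̂‖ with η_d = (κ_T/κ)/(1 − κ_T/κ) < 1. -/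
open Matrix

/-- Euclidean norm of a finitely indexed real vector. -/
noncomputable def euclNorm {ι : Type*} [Fintype ι] (v : ι → ℝ) : ℝ :=
  Real.sqrt (∑ i, v i ^ 2)

theorem euclNorm_eq_norm_toLp {ι : Type*} [Fintype ι] (v : ι → ℝ) :
    euclNorm v = ‖WithLp.toLp 2 v‖ := by
  simp [euclNorm, EuclideanSpace.norm_eq]

theorem euclNorm_add_le {ι : Type*} [Fintype ι] (v w : ι → ℝ) :
    euclNorm (v + w) ≤ euclNorm v + euclNorm w := by
  simp only [euclNorm_eq_norm_toLp, WithLp.toLp_add]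
  exact norm_add_le _ _

theorem euclNorm_le_euclNorm_sumElim {ι ι' : Type*} [Fintype ι] [Fintype ι']
    (v : ι → ℝ) (w : ι' → ℝ) : euclNorm v ≤ euclNorm (Sum.elim v w) := by
  apply Real.sqrt_le_sqrt
  rw [Fintype.sum_sum_type]
  exact le_add_of_nonneg_right (Finset.sum_nonneg fun i _ => sq_nonneg _)

/-- Lemma 2.3, first case: relative error of an inexact SQP direction under the
residual condition `‖(ρ, r)‖ ≤ κ_T ‖d‖`, where the KKT matrix
`M = [[H, Jᵀ], [J, 0]]` is invertible with `‖M⁻¹‖ ≤ 1/κ` (Euclidean operator norm). -/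
theorem inexact_sqp_direction_relative_error_caseI
    {n m : ℕ} (H : Matrix (Fin n) (Fin n) ℝ) (hH : H.IsSymm)
    (J : Matrix (Fin m) (Fin n) ℝ)
    (M : Matrix (Fin n ⊕ Fin m) (Fin n ⊕ Fin m) ℝ)
    (hM : M = Matrix.fromBlocks H Jᵀ J 0)
    (hMunit : IsUnit M)
    (κ : ℝ) (hκ : 0 < κ)
    -- `‖M⁻¹‖ ≤ 1/κ` for the operator norm induced by the Euclidean norm:
    (hMinv : ∀ w : Fin n ⊕ Fin m → ℝ, euclNorm (M⁻¹.mulVec w) ≤ (1 / κ) * euclNorm w)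
    (d dh : Fin n → ℝ) (δ δh : Fin m → ℝ) (ρ : Fin n → ℝ) (r : Fin m → ℝ)
    (heq : M.mulVec (Sum.elim (d - dh) (δ - δh)) = Sum.elim ρ r)
    (κT : ℝ) (hκT0 : 0 ≤ κT) (hκT : κT / κ < 1 / 2)
    (hres : euclNorm (Sum.elim ρ r) ≤ κT * euclNorm d) :
    euclNorm (d - dh) ≤ ((κT / κ) / (1 - κT / κ)) * euclNorm dh
      ∧ (κT / κ) / (1 - κT / κ) < 1 := by
  have ht : 0 < 1 - κT / κ := by linarith
  refine ⟨?_, by rw [div_lt_one ht]; linarith⟩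
  have hinv : M⁻¹.mulVec (Sum.elim ρ r) = Sum.elim (d - dh) (δ - δh) := by
    rw [← heq, Matrix.mulVec_mulVec,
      Matrix.nonsing_inv_mul M ((Matrix.isUnit_iff_isUnit_det M).1 hMunit), Matrix.one_mulVec]
  have herr : euclNorm (d - dh) ≤ κT / κ * euclNorm d :=
    calc euclNorm (d - dh) ≤ euclNorm (Sum.elim (d - dh) (δ - δh)) :=
          euclNorm_le_euclNorm_sumElim _ _
      _ ≤ 1 / κ * euclNorm (Sum.elim ρ r) := hinv ▸ hMinv _
      _ ≤ 1 / κ * (κT * euclNorm d) := by gcongr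
      _ = κT / κ * euclNorm d := by ring
  have htri : euclNorm d ≤ euclNorm (d - dh) + euclNorm dh := by
    simpa using euclNorm_add_le (d - dh) dh
  have hscaled := mul_le_mul_of_nonneg_left htri (div_nonneg hκT0 hκ.le)
  rw [div_mul_eq_mul_div, le_div_iff₀ ht]
  linarith
end

section
/- Let E be a real normed space, let η ∈ [0,1), κ > 0, γ ≥ 0, ε ≥ 0, and E₀, E_N ≥ 0. Let d₀, d̂₀, d₀ᵗ, d_N, d̂_N, d_Nᵗ ∈ E satisfy: ‖d₀ − d̂₀‖ ≤ η ‖d̂₀‖; ‖d_N − d̂_N‖ ≤ η ‖d̂_N‖; ‖d̂₀ − d₀ᵗ‖ ≤ E₀/κ; ‖d̂_N − d_Nᵗ‖ ≤ E_N/κ; and ‖d_N‖ ≤ γ ‖d₀‖ + ε. Then ‖d_Nᵗ‖ ≤ γ (1+η)/(1−η) ‖d₀ᵗ‖ + ε/(1−η) + (1+η)/((1−η)κ) E_N + γ (1+η)/((1−η)κ) E₀. -/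
/-- Lemma 2.4 (deterministic inequality chain): bound on the norm of the
true-gradient SQP direction at the end of an inner loop, given relative
inexactness `η`, KKT-matrix inverse bound `1/κ`, gradient errors `E₀, E_N`,
and the termination criterion `‖d_N‖ ≤ γ ‖d₀‖ + ε`. -/
theorem true_direction_norm_bound_single_outer_iteration
    {V : Type*} [NormedAddCommGroup V]
    (η : ℝ) (hη0 : 0 ≤ η) (hη1 : η < 1)
    (κ : ℝ) (hκ : 0 < κ)
    (γ ε : ℝ) (hγ : 0 ≤ γ) (hε : 0 ≤ ε)
    (E₀ EN : ℝ) (hE₀ : 0 ≤ E₀) (hEN : 0 ≤ EN)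
    (d₀ dh₀ dt₀ dN dhN dtN : V)
    (h₁ : ‖d₀ - dh₀‖ ≤ η * ‖dh₀‖)
    (h₂ : ‖dN - dhN‖ ≤ η * ‖dhN‖)
    (h₃ : ‖dh₀ - dt₀‖ ≤ E₀ / κ)
    (h₄ : ‖dhN - dtN‖ ≤ EN / κ)
    (h₅ : ‖dN‖ ≤ γ * ‖d₀‖ + ε) :
    ‖dtN‖ ≤ γ * ((1 + η) / (1 - η)) * ‖dt₀‖ + ε / (1 - η)
      + ((1 + η) / ((1 - η) * κ)) * EN + γ * ((1 + η) / ((1 - η) * κ)) * E₀ := by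
  have hη : 0 < 1 - η := by linarith
  have start_exact : ‖dh₀‖ ≤ ‖dt₀‖ + E₀ / κ := by
    linarith [norm_le_norm_add_norm_sub' dh₀ dt₀]
  have start_computed : ‖d₀‖ ≤ (1 + η) * (‖dt₀‖ + E₀ / κ) :=
    calc ‖d₀‖ ≤ (1 + η) * ‖dh₀‖ := by linarith [norm_le_norm_add_norm_sub' d₀ dh₀]
      _ ≤ (1 + η) * (‖dt₀‖ + E₀ / κ) := by gcongr
  have end_computed : ‖dN‖ ≤ γ * ((1 + η) * (‖dt₀‖ + E₀ / κ)) + ε :=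
    h₅.trans (by gcongr)
  have end_exact : ‖dhN‖ ≤ (γ * ((1 + η) * (‖dt₀‖ + E₀ / κ)) + ε) / (1 - η) := by
    rw [le_div_iff₀ hη]
    linarith [norm_le_norm_add_norm_sub dN dhN]
  have end_error : EN / κ ≤ (1 + η) / (1 - η) * (EN / κ) :=
    le_mul_of_one_le_left (by positivity) ((one_le_div hη).2 (by linarith))
  calc ‖dtN‖ ≤ ‖dhN‖ + EN / κ := by linarith [norm_le_norm_add_norm_sub dhN dtN]
    _ ≤ (γ * ((1 + η) * (‖dt₀‖ + E₀ / κ)) + ε) / (1 - η)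
        + (1 + η) / (1 - η) * (EN / κ) := add_le_add end_exact end_error
    _ = _ := by
      field_simp
      ring
end

section
/- Let η ∈ [0,1), κ > 0, γ, ω, ω̂, θ, θ̂, a ≥ 0, β ∈ (0,1). Let (D_k)_{k≥0}, (E_k)_{k≥1}, (E'_k)_{k≥1} be nonnegative real sequences satisfying, for all k ≥ 1: (i) D_k ≤ γ (1+η)/(1−η) D_{k−1} + (ω E_k + ω̂ β^k)/(1−η) + (1+η)/((1−η)κ) E'_k + γ (1+η)/((1−η)κ) E_k; (ii) E_k² ≤ θ² D_{k−1}² + a² β^{2k} and E'_k² ≤ θ̂² (θ² D_{k−1}² + a² β^{2k}). Suppose a₁ := (1/(1−η)) [γ(1+η) + θ(ω + (γ + θ̂)(1+η)/κ)] < 1 and ν > 0 satisfies a₁ + ν < 1. Then for all k ≥ 0, D_k ≤ (max{a₁ + ν, β})^k · max{D₀, a₂/ν}, where a₂ = (a/(1−η)) (ω + (γ + θ̂)(1+η)/κ) + ω̂/(1−η). -/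
/-- A sequence with `u (k + 1) ≤ p * u k + q * β ^ (k + 1)` decays at the rate
`max (p + ν) β`, for every `ν > 0`. -/
theorem le_max_pow_mul_max_of_le_mul_add_mul_pow {u : ℕ → ℝ} {p q ν β : ℝ}
    (hp : 0 ≤ p) (hq : 0 ≤ q) (hν : 0 < ν) (hβ0 : 0 ≤ β) (hβ1 : β ≤ 1)
    (hu0 : 0 ≤ u 0) (hu : ∀ k, u (k + 1) ≤ p * u k + q * β ^ (k + 1)) (k : ℕ) :
    u k ≤ max (p + ν) β ^ k * max (u 0) (q / ν) := by
  set ρ := max (p + ν) β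
  set M := max (u 0) (q / ν)
  have hβρ : β ≤ ρ := le_max_right _ _
  have hM : 0 ≤ M := hu0.trans (le_max_left _ _)
  have hqM : q ≤ M * ν := (div_le_iff₀ hν).mp (le_max_right _ _)
  induction k with
  | zero => simp [M]
  | succ k ih =>
    have hρk : 0 ≤ ρ ^ k := pow_nonneg (hβ0.trans hβρ) k
    have hβk : β ^ (k + 1) ≤ ρ ^ k :=
      (pow_le_pow_of_le_one hβ0 hβ1 k.le_succ).trans (pow_le_pow_left₀ hβ0 hβρ k)
    calc u (k + 1) ≤ p * u k + q * β ^ (k + 1) := hu k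
      _ ≤ p * (ρ ^ k * M) + q * ρ ^ k := by gcongr
      _ ≤ p * (ρ ^ k * M) + M * ν * ρ ^ k := by gcongr
      _ = (p + ν) * (ρ ^ k * M) := by ring
      _ ≤ ρ * (ρ ^ k * M) := by gcongr; exact le_max_left _ _
      _ = ρ ^ (k + 1) * M := by ring

theorem sq_mul_sq_add_le_sq_add {θ d a b : ℝ} (hθ : 0 ≤ θ) (hd : 0 ≤ d) (ha : 0 ≤ a)
    (hb : 0 ≤ b) : θ ^ 2 * d ^ 2 + a ^ 2 * b ^ 2 ≤ (θ * d + a * b) ^ 2 := by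
  have : 0 ≤ θ * d * (a * b) := by positivity
  nlinarith

/-- Theorem 2.4(1): linear convergence of the true search-direction norms `D k`
for the equality-constrained RA-SQP method with the search-direction-norm
termination criterion (finite-sum case), stated for real sequences. -/
theorem ra_sqp_direction_norm_linear_rate
    (η : ℝ) (hη0 : 0 ≤ η) (hη1 : η < 1)
    (κ : ℝ) (hκ : 0 < κ)
    (γ ω ωh θ θh a : ℝ)
    (hγ : 0 ≤ γ) (hω : 0 ≤ ω) (hωh : 0 ≤ ωh) (hθ : 0 ≤ θ) (hθh : 0 ≤ θh) (ha : 0 ≤ a)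
    (β : ℝ) (hβ0 : 0 < β) (hβ1 : β < 1)
    (D Ek Ek' : ℕ → ℝ)
    (hD : ∀ k, 0 ≤ D k) (hE : ∀ k, 0 ≤ Ek (k + 1)) (hE' : ∀ k, 0 ≤ Ek' (k + 1))
    -- (i) recursion from Lemma 2.4 with tolerance ε_k = ω E_k + ω̂ βᵏ:
    (hrec : ∀ k, D (k + 1)
      ≤ γ * ((1 + η) / (1 - η)) * D k
        + (ω * Ek (k + 1) + ωh * β ^ (k + 1)) / (1 - η)
        + ((1 + η) / ((1 - η) * κ)) * Ek' (k + 1)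
        + γ * ((1 + η) / ((1 - η) * κ)) * Ek (k + 1))
    -- (ii) adaptive sampling condition:
    (hsamp₁ : ∀ k, (Ek (k + 1)) ^ 2 ≤ θ ^ 2 * (D k) ^ 2 + a ^ 2 * β ^ (2 * (k + 1)))
    (hsamp₂ : ∀ k, (Ek' (k + 1)) ^ 2
      ≤ θh ^ 2 * (θ ^ 2 * (D k) ^ 2 + a ^ 2 * β ^ (2 * (k + 1))))
    -- contraction-factor condition:
    (ha₁ : (1 / (1 - η)) * (γ * (1 + η) + θ * (ω + (γ + θh) * (1 + η) / κ)) < 1)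
    (ν : ℝ) (hν : 0 < ν)
    (hν₁ : (1 / (1 - η)) * (γ * (1 + η) + θ * (ω + (γ + θh) * (1 + η) / κ)) + ν < 1) :
    ∀ k, D k
      ≤ (max ((1 / (1 - η)) * (γ * (1 + η) + θ * (ω + (γ + θh) * (1 + η) / κ)) + ν) β) ^ k
        * max (D 0) (((a / (1 - η)) * (ω + (γ + θh) * (1 + η) / κ) + ωh / (1 - η)) / ν) := by
  have hη : 0 < 1 - η := sub_pos.mpr hη1
  refine le_max_pow_mul_max_of_le_mul_add_mul_pow (by positivity) (by positivity) hν hβ0.le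
    hβ1.le (hD 0) fun k => ?_
  have hDk := hD k
  have hsq := sq_mul_sq_add_le_sq_add hθ hDk ha (pow_nonneg hβ0.le (k + 1))
  rw [← pow_mul, mul_comm (k + 1) 2] at hsq
  have h₁ : Ek (k + 1) ≤ θ * D k + a * β ^ (k + 1) :=
    le_of_pow_le_pow_left₀ two_ne_zero (by positivity) ((hsamp₁ k).trans hsq)
  have h₂ : Ek' (k + 1) ≤ θh * (θ * D k + a * β ^ (k + 1)) := by
    refine le_of_pow_le_pow_left₀ two_ne_zero (by positivity) ((hsamp₂ k).trans ?_)
    rw [mul_pow]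
    gcongr
  calc D (k + 1)
      ≤ γ * ((1 + η) / (1 - η)) * D k
        + (ω * Ek (k + 1) + ωh * β ^ (k + 1)) / (1 - η)
        + ((1 + η) / ((1 - η) * κ)) * Ek' (k + 1)
        + γ * ((1 + η) / ((1 - η) * κ)) * Ek (k + 1) := hrec k
    _ ≤ γ * ((1 + η) / (1 - η)) * D k
        + (ω * (θ * D k + a * β ^ (k + 1)) + ωh * β ^ (k + 1)) / (1 - η)
        + ((1 + η) / ((1 - η) * κ)) * (θh * (θ * D k + a * β ^ (k + 1)))
        + γ * ((1 + η) / ((1 - η) * κ)) * (θ * D k + a * β ^ (k + 1)) := by gcongr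
    _ = _ := by
      field_simp
      ring
end

section
/- Let E be a finite-dimensional real inner product space, K ⊆ E a nonempty convex set, and A : E → E a symmetric linear map with ⟨u, A u⟩ ≥ μ ‖u‖² for all u ∈ E, where μ > 0. Let g₁, g₂ ∈ E, and suppose d₁ ∈ K minimizes u ↦ ⟨g₁, u⟩ + ½⟨u, A u⟩ over K and d₂ ∈ K minimizes u ↦ ⟨g₂, u⟩ + ½⟨u, A u⟩ over K. Then ‖d₁ − d₂‖ ≤ ‖g₁ − g₂‖/μ. -/
open scoped RealInnerProductSpace

/-- First-order variational inequality for a minimizer of a quadratic function over a convex set. -/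
theorem inner_add_nonneg_of_quadratic_min
    {E : Type*} [NormedAddCommGroup E] [InnerProductSpace ℝ E]
    {K : Set E} (hK : Convex ℝ K)
    {A : E →ₗ[ℝ] E} (hA : ∀ u v : E, ⟪A u, v⟫ = ⟪u, A v⟫)
    {g d u : E} (hd : d ∈ K) (hu : u ∈ K)
    (hmin : ∀ v ∈ K, ⟪g, d⟫ + (1 / 2) * ⟪d, A d⟫ ≤ ⟪g, v⟫ + (1 / 2) * ⟪v, A v⟫) :
    0 ≤ ⟪g + A d, u - d⟫ := by
  set w := u - d with hw
  have hstep : ∀ t : ℝ, 0 < t → t ≤ 1 → 0 ≤ ⟪g + A d, w⟫ + t / 2 * ⟪w, A w⟫ := by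
    intro t ht ht1
    have h := hmin _ (hK.add_smul_sub_mem hd hu ⟨ht.le, ht1⟩)
    rw [← hw] at h
    simp only [map_add, map_smul, inner_add_left, inner_add_right, real_inner_smul_left,
      real_inner_smul_right, ← hA d w, real_inner_comm (A d) w] at h
    rw [inner_add_left]
    refine nonneg_of_mul_nonneg_right (a := t) ?_ ht
    linarith
  by_contra! ha
  set a := ⟪g + A d, w⟫
  set b := ⟪w, A w⟫
  have hpos : 0 < |b| - a := by linarith [abs_nonneg b]
  have h := hstep (-a / (|b| - a)) (div_pos (by linarith) hpos)
    ((div_le_one hpos).2 (by linarith [abs_nonneg b]))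
  have hb : -a / (|b| - a) * b ≤ -a := by
    rw [div_mul_eq_mul_div, div_le_iff₀ hpos]
    nlinarith [le_abs_self b]
  linarith

/-- Perturbation estimate for strongly convex quadratic programs over a common
convex set: the minimizers for objectives with gradients `g₁` and `g₂` satisfy
`‖d₁ − d₂‖ ≤ ‖g₁ − g₂‖ / μ`. -/
theorem strongly_convex_qp_perturbation
    {E : Type*} [NormedAddCommGroup E] [InnerProductSpace ℝ E] [FiniteDimensional ℝ E]
    (K : Set E) (hKne : K.Nonempty) (hKconv : Convex ℝ K)
    (A : E →ₗ[ℝ] E) (hAsymm : ∀ u v : E, ⟪A u, v⟫ = ⟪u, A v⟫)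
    (μ : ℝ) (hμ : 0 < μ) (hAcoer : ∀ u : E, μ * ‖u‖ ^ 2 ≤ ⟪u, A u⟫)
    (g₁ g₂ d₁ d₂ : E) (hd₁K : d₁ ∈ K) (hd₂K : d₂ ∈ K)
    (hd₁ : ∀ u ∈ K, ⟪g₁, d₁⟫ + (1 / 2) * ⟪d₁, A d₁⟫ ≤ ⟪g₁, u⟫ + (1 / 2) * ⟪u, A u⟫)
    (hd₂ : ∀ u ∈ K, ⟪g₂, d₂⟫ + (1 / 2) * ⟪d₂, A d₂⟫ ≤ ⟪g₂, u⟫ + (1 / 2) * ⟪u, A u⟫) :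
    ‖d₁ - d₂‖ ≤ ‖g₁ - g₂‖ / μ := by
  have h₁ := inner_add_nonneg_of_quadratic_min hKconv hAsymm hd₁K hd₂K hd₁
  have h₂ := inner_add_nonneg_of_quadratic_min hKconv hAsymm hd₂K hd₁K hd₂
  have hcoer := hAcoer (d₁ - d₂)
  have hmono : ⟪d₁ - d₂, A (d₁ - d₂)⟫ ≤ ⟪g₂ - g₁, d₁ - d₂⟫ := by
    rw [← hAsymm, map_sub]
    rw [← neg_sub d₁ d₂, inner_neg_right] at h₁
    simp only [inner_add_left, inner_sub_left] at h₁ h₂ ⊢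
    linarith
  have hcs := real_inner_le_norm (g₂ - g₁) (d₁ - d₂)
  rw [norm_sub_rev g₂ g₁] at hcs
  rw [le_div_iff₀ hμ]
  rcases (norm_nonneg (d₁ - d₂)).eq_or_lt with h0 | hpos
  · simp [← h0]
  · refine le_of_mul_le_mul_right ?_ hpos
    linarith
end

section
/- Let E be a finite-dimensional real inner product space and μ > 0. Let K₀, K_N ⊆ E be nonempty convex sets, let A₀, A_N : E → E be symmetric linear maps with ⟨u, A₀ u⟩ ≥ μ‖u‖² and ⟨u, A_N u⟩ ≥ μ‖u‖² for all u, and let g₀, g₀ᵗ, g_N, g_Nᵗ ∈ E. Suppose d₀ minimizes u ↦ ⟨g₀, u⟩ + ½⟨u, A₀ u⟩ over K₀, d₀ᵗ minimizes u ↦ ⟨g₀ᵗ, u⟩ + ½⟨u, A₀ u⟩ over K₀, d_N minimizes u ↦ ⟨g_N, u⟩ + ½⟨u, A_N u⟩ over K_N, and d_Nᵗ minimizes u ↦ ⟨g_Nᵗ, u⟩ + ½⟨u, A_N u⟩ over K_N. If γ ≥ 0, ε ≥ 0 and ‖d_N‖ ≤ γ ‖d₀‖ + ε, then ‖d_Nᵗ‖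 ≤ γ ‖d₀ᵗ‖ + ε + ‖g_Nᵗ − g_N‖/μ + γ ‖g₀ᵗ − g₀‖/μ. -/
open scoped RealInnerProductSpace

section QuadraticProgram

variable {E : Type*} [NormedAddCommGroup E] [InnerProductSpace ℝ E]

/-- First-order optimality condition for the minimizer of a quadratic function over a convex
set. -/
theorem inner_gradient_nonneg_of_quadratic_minimizer {K : Set E} (hK : Convex ℝ K)
    {A : E →ₗ[ℝ] E} (hA : ∀ u v : E, ⟪A u, v⟫ = ⟪u, A v⟫) {g d u : E} (hd : d ∈ K)
    (hmin : ∀ v ∈ K, ⟪g, d⟫ + (1 / 2) * ⟪d, A d⟫ ≤ ⟪g, v⟫ + (1 / 2) * ⟪v, A v⟫)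
    (hu : u ∈ K) : 0 ≤ ⟪g + A d, u - d⟫ := by
  set c := ⟪g + A d, u - d⟫ with hc
  set q := ⟪u - d, A (u - d)⟫ with hq
  have key : ∀ t : ℝ, 0 ≤ t → t ≤ 1 → 0 ≤ t * c + t ^ 2 / 2 * q := by
    intro t ht0 ht1
    have h := hmin _ (hK.add_smul_sub_mem hd hu ⟨ht0, ht1⟩)
    have hsymm : ⟪u - d, A d⟫ = ⟪d, A (u - d)⟫ := by
      rw [← hA, real_inner_comm]
    have hc' : c = ⟪g, u - d⟫ + ⟪d, A (u - d)⟫ := by rw [hc, inner_add_left, hA]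
    rw [map_add, map_smul, inner_add_right, inner_add_left, inner_add_right, inner_add_right,
      real_inner_smul_left, real_inner_smul_left, real_inner_smul_right, real_inner_smul_right,
      real_inner_smul_right, hsymm, ← hq] at h
    rw [hc']
    linarith
  by_contra! hneg
  have hpos : 0 < |q| - c := by linarith [abs_nonneg q]
  have h := key (-c / (|q| - c)) (div_nonneg (by linarith) hpos.le)
    ((div_le_one hpos).2 (by linarith [abs_nonneg q]))
  have ht : 0 < -c / (|q| - c) := div_pos (by linarith) hpos
  have hmul : -c / (|q| - c) * (|q| - c) = -c := div_mul_cancel₀ _ hpos.ne'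
  generalize -c / (|q| - c) = t at h ht hmul
  have h2 : 0 ≤ c + t / 2 * q := by
    refine nonneg_of_mul_nonneg_right ?_ ht
    linarith
  nlinarith [mul_le_mul_of_nonneg_left (le_abs_self q) ht.le, mul_neg_of_pos_of_neg ht hneg]

/-- Minimizers of strongly convex quadratic functions with a common Hessian over a common convex
set depend on the linear term in a Lipschitz way. -/
theorem norm_quadratic_minimizer_sub_le {μ : ℝ} (hμ : 0 < μ) {K : Set E} (hK : Convex ℝ K)
    {A : E →ₗ[ℝ] E} (hA : ∀ u v : E, ⟪A u, v⟫ = ⟪u, A v⟫)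
    (hcoer : ∀ u : E, μ * ‖u‖ ^ 2 ≤ ⟪u, A u⟫) {g g' d d' : E} (hd : d ∈ K) (hd' : d' ∈ K)
    (hmin : ∀ u ∈ K, ⟪g, d⟫ + (1 / 2) * ⟪d, A d⟫ ≤ ⟪g, u⟫ + (1 / 2) * ⟪u, A u⟫)
    (hmin' : ∀ u ∈ K, ⟪g', d'⟫ + (1 / 2) * ⟪d', A d'⟫ ≤ ⟪g', u⟫ + (1 / 2) * ⟪u, A u⟫) :
    ‖d - d'‖ ≤ ‖g - g'‖ / μ := by
  have h := inner_gradient_nonneg_of_quadratic_minimizer hK hA hd hmin hd'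
  have h' := inner_gradient_nonneg_of_quadratic_minimizer hK hA hd' hmin' hd
  have hsum : ⟪d - d', A (d - d')⟫ ≤ -⟪g - g', d - d'⟫ := by
    rw [← neg_sub d d', inner_neg_right, inner_add_left] at h
    rw [inner_add_left] at h'
    rw [← hA, map_sub, inner_sub_left, inner_sub_left]
    linarith
  have hcs := (neg_le_abs _).trans (abs_real_inner_le_norm (g - g') (d - d'))
  have hsq := (hcoer (d - d')).trans (hsum.trans hcs)
  rw [le_div_iff₀ hμ]
  rcases (norm_nonneg (d - d')).eq_or_lt with h0 | h0
  · rw [← h0, zero_mul]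
    exact norm_nonneg _
  · refine le_of_mul_le_mul_right ?_ h0
    linarith

end QuadraticProgram

/-- Lemma 3.1 (deterministic content, single outer iteration): bound on the norm of
the true-gradient robust-SQP direction `d_Nᵗ` in terms of the termination criterion
`‖d_N‖ ≤ γ ‖d₀‖ + ε` and the gradient errors, where each direction minimizes a
strongly convex quadratic over the corresponding convex feasible region. -/
theorem robust_sqp_true_direction_bound
    {E : Type*} [NormedAddCommGroup E] [InnerProductSpace ℝ E] [FiniteDimensional ℝ E]
    (μ : ℝ) (hμ : 0 < μ)
    (K₀ KN : Set E) (hK₀ne : K₀.Nonempty) (hKNne : KN.Nonempty)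
    (hK₀conv : Convex ℝ K₀) (hKNconv : Convex ℝ KN)
    (A₀ AN : E →ₗ[ℝ] E)
    (hA₀symm : ∀ u v : E, ⟪A₀ u, v⟫ = ⟪u, A₀ v⟫)
    (hANsymm : ∀ u v : E, ⟪AN u, v⟫ = ⟪u, AN v⟫)
    (hA₀coer : ∀ u : E, μ * ‖u‖ ^ 2 ≤ ⟪u, A₀ u⟫)
    (hANcoer : ∀ u : E, μ * ‖u‖ ^ 2 ≤ ⟪u, AN u⟫)
    (g₀ g₀t gN gNt d₀ d₀t dN dNt : E)
    (hd₀K : d₀ ∈ K₀) (hd₀tK : d₀t ∈ K₀) (hdNK : dN ∈ KN) (hdNtK : dNt ∈ KN)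
    (hd₀ : ∀ u ∈ K₀, ⟪g₀, d₀⟫ + (1 / 2) * ⟪d₀, A₀ d₀⟫ ≤ ⟪g₀, u⟫ + (1 / 2) * ⟪u, A₀ u⟫)
    (hd₀t : ∀ u ∈ K₀, ⟪g₀t, d₀t⟫ + (1 / 2) * ⟪d₀t, A₀ d₀t⟫ ≤ ⟪g₀t, u⟫ + (1 / 2) * ⟪u, A₀ u⟫)
    (hdN : ∀ u ∈ KN, ⟪gN, dN⟫ + (1 / 2) * ⟪dN, AN dN⟫ ≤ ⟪gN, u⟫ + (1 / 2) * ⟪u, AN u⟫)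
    (hdNt : ∀ u ∈ KN, ⟪gNt, dNt⟫ + (1 / 2) * ⟪dNt, AN dNt⟫ ≤ ⟪gNt, u⟫ + (1 / 2) * ⟪u, AN u⟫)
    (γ ε : ℝ) (hγ : 0 ≤ γ) (hε : 0 ≤ ε)
    (hterm : ‖dN‖ ≤ γ * ‖d₀‖ + ε) :
    ‖dNt‖ ≤ γ * ‖d₀t‖ + ε + ‖gNt - gN‖ / μ + γ * ‖g₀t - g₀‖ / μ := by
  have h₀ := norm_quadratic_minimizer_sub_le hμ hK₀conv hA₀symm hA₀coer hd₀tK hd₀K hd₀t hd₀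
  have hN := norm_quadratic_minimizer_sub_le hμ hKNconv hANsymm hANcoer hdNtK hdNK hdNt hdN
  have htri₀ : ‖d₀‖ ≤ ‖d₀t‖ + ‖d₀t - d₀‖ := norm_le_insert d₀t d₀
  have htriN : ‖dNt‖ ≤ ‖dN‖ + ‖dNt - dN‖ := norm_le_insert' dNt dN
  have hmul := mul_le_mul_of_nonneg_left (htri₀.trans (add_le_add_right h₀ _)) hγ
  rw [mul_add, ← mul_div_assoc] at hmul
  linarith
end

section
/- Let μ > 0, γ, ω, ω̂, θ, θ̂, a ≥ 0, β ∈ (0,1). Let (D_k)_{k≥0}, (E_k)_{k≥1}, (E'_k)_{k≥1} be nonnegative real sequences satisfying, for all k ≥ 1: (i) D_k ≤ γ D_{k−1} + (ω E_k + ω̂ β^k) + (1/μ) E'_k + (γ/μ) E_k; (ii) E_k² ≤ θ² D_{k−1}² + a² β^{2k} and E'_k² ≤ θ̂² (θ² D_{k−1}² + a² β^{2k}). Suppose a₁ := γ + θ (ω + (θ̂ + γ)/μ) < 1 and ν > 0 satisfies a₁ + ν < 1. Then for all k ≥ 0, D_k ≤ (max{a₁ + ν, β})^k · max{D₀, a₂/ν},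 where a₂ = a (ω + (θ̂ + γ)/μ) + ω̂. -/
/-- A nonnegative contraction perturbed by a geometrically decaying term converges linearly. -/
theorem le_max_pow_mul_max_of_le_mul_add_mul_pow_s19 {D : ℕ → ℝ} {c b β ν : ℝ}
    (hc : 0 ≤ c) (hb : 0 ≤ b) (hβ0 : 0 ≤ β) (hβ1 : β ≤ 1) (hν : 0 < ν)
    (h : ∀ k, D (k + 1) ≤ c * D k + b * β ^ (k + 1)) (k : ℕ) :
    D k ≤ max (c + ν) β ^ k * max (D 0) (b / ν) := by
  induction k with
  | zero => simp
  | succ k ih =>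
    set ρ := max (c + ν) β
    set M := max (D 0) (b / ν)
    have hρ : c + ν ≤ ρ := le_max_left _ _
    have hbM : b ≤ M * ν := (div_le_iff₀ hν).1 (le_max_right _ _)
    have hM : 0 ≤ M := (div_nonneg hb hν.le).trans (le_max_right _ _)
    have hρ0 : 0 ≤ ρ := by linarith
    have hpow : β ^ (k + 1) ≤ ρ ^ k :=
      (pow_le_pow_of_le_one hβ0 hβ1 k.le_succ).trans
        (pow_le_pow_left₀ hβ0 (le_max_right _ _) k)
    calc D (k + 1) ≤ c * D k + b * β ^ (k + 1) := h k
      _ ≤ c * (ρ ^ k * M) + M * ν * ρ ^ k := by gcongr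
      _ = (c + ν) * (ρ ^ k * M) := by ring
      _ ≤ ρ * (ρ ^ k * M) := by gcongr
      _ = ρ ^ (k + 1) * M := by ring

/-- Theorem 3.2(1): linear convergence of the true robust-SQP search-direction
norms `D k` across outer iterations of the inequality-constrained RA-SQP method
(finite-sum case), stated for real sequences. -/
theorem ra_inequality_direction_norm_linear_rate
    (μ : ℝ) (hμ : 0 < μ)
    (γ ω ωh θ θh a : ℝ)
    (hγ : 0 ≤ γ) (hω : 0 ≤ ω) (hωh : 0 ≤ ωh) (hθ : 0 ≤ θ) (hθh : 0 ≤ θh) (ha : 0 ≤ a)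
    (β : ℝ) (hβ0 : 0 < β) (hβ1 : β < 1)
    (D Ek Ek' : ℕ → ℝ)
    (hD : ∀ k, 0 ≤ D k) (hE : ∀ k, 0 ≤ Ek (k + 1)) (hE' : ∀ k, 0 ≤ Ek' (k + 1))
    -- (i) recursion from Lemma 3.1 with tolerance ε_k = ω E_k + ω̂ βᵏ:
    (hrec : ∀ k, D (k + 1)
      ≤ γ * D k + (ω * Ek (k + 1) + ωh * β ^ (k + 1))
        + (1 / μ) * Ek' (k + 1) + (γ / μ) * Ek (k + 1))
    -- (ii) adaptive sampling condition:
    (hsamp₁ : ∀ k, (Ek (k + 1)) ^ 2 ≤ θ ^ 2 * (D k) ^ 2 + a ^ 2 * β ^ (2 * (k + 1)))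
    (hsamp₂ : ∀ k, (Ek' (k + 1)) ^ 2
      ≤ θh ^ 2 * (θ ^ 2 * (D k) ^ 2 + a ^ 2 * β ^ (2 * (k + 1))))
    -- contraction-factor condition:
    (ha₁ : γ + θ * (ω + (θh + γ) / μ) < 1)
    (ν : ℝ) (hν : 0 < ν) (hν₁ : γ + θ * (ω + (θh + γ) / μ) + ν < 1) :
    ∀ k, D k ≤ (max (γ + θ * (ω + (θh + γ) / μ) + ν) β) ^ k
      * max (D 0) ((a * (ω + (θh + γ) / μ) + ωh) / ν) := by
  have hs : ∀ k, θ ^ 2 * D k ^ 2 + a ^ 2 * β ^ (2 * (k + 1))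
      ≤ (θ * D k + a * β ^ (k + 1)) ^ 2 := fun k => by
    have h : 0 ≤ (θ * D k) * (a * β ^ (k + 1)) :=
      mul_nonneg (mul_nonneg hθ (hD k)) (by positivity)
    rw [mul_comm 2 (k + 1), pow_mul]
    nlinarith
  have hs0 : ∀ k, 0 ≤ θ * D k + a * β ^ (k + 1) := fun k =>
    add_nonneg (mul_nonneg hθ (hD k)) (by positivity)
  have hEk : ∀ k, Ek (k + 1) ≤ θ * D k + a * β ^ (k + 1) := fun k =>
    le_of_abs_le <| abs_le_of_sq_le_sq ((hsamp₁ k).trans (hs k)) (hs0 k)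
  have hEk' : ∀ k, Ek' (k + 1) ≤ θh * (θ * D k + a * β ^ (k + 1)) := fun k => by
    refine le_of_abs_le <| abs_le_of_sq_le_sq ((hsamp₂ k).trans ?_) (mul_nonneg hθh (hs0 k))
    rw [mul_pow]
    exact mul_le_mul_of_nonneg_left (hs k) (sq_nonneg θh)
  refine le_max_pow_mul_max_of_le_mul_add_mul_pow_s19 (by positivity) (by positivity)
    hβ0.le hβ1.le hν fun k => ?_
  calc D (k + 1)
      ≤ γ * D k + (ω * Ek (k + 1) + ωh * β ^ (k + 1))
        + (1 / μ) * Ek' (k + 1) + (γ / μ) * Ek (k + 1) := hrec k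
    _ ≤ γ * D k + (ω * (θ * D k + a * β ^ (k + 1)) + ωh * β ^ (k + 1))
        + (1 / μ) * (θh * (θ * D k + a * β ^ (k + 1)))
        + (γ / μ) * (θ * D k + a * β ^ (k + 1)) := by
      gcongr
      exacts [hEk k, hEk' k, hEk k]
    _ = _ := by ring
end
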